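/- arXiv:1604.01980 — 4 statements merged into one kernel-verified Lean document; each statement's English description precedes it below -/
import Mathlib

section
/- Let ρ̂ : ℝ^L → ℝ ∪ {+∞} be the lifted dataterm ρ̂(u) = min_{1≤i≤m} ρ̂_i(u), where ρ̂_i(u) = ρ(T_i α) if u = E_i α for some α in the unit simplex Δ^U_{n+1}, and ρ̂_i(u) = +∞ otherwise. Then the biconjugate (convex envelope) of ρ̂ is given by ρ̂**(u) = sup_{v ∈ ℝ^L} ⟨u, v⟩ − max_{1≤i≤m} ρ̂_i*(v), where ρ̂_i*(v) = ⟨E_i b_i, v⟩ + (ρ + δ_{Δ_i})*(A_iᵀ E_iᵀ v); here M_i := (T_iᵀ, 𝟙)^{−ᵀ} ∈ ℝ^{(n+1)×(n+1)} (the inverse transpose of the matrix obtained by appending the all-ones column 𝟙 to T_iᵀ), b_i := M_i^{n+1} is the last column of M_i, and A_i := (M_i^1, …, M_i^n) ∈ ℝ^{(n+1)×n} consists of the first n columns of M_i. -/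
open Matrix

/-- The convex conjugate (w.r.t. the Euclidean inner product) of an
`EReal`-valued function on `ι → ℝ`. -/
noncomputable def conj {ι : Type*} [Fintype ι] (f : (ι → ℝ) → EReal) (v : ι → ℝ) : EReal :=
  ⨆ u : ι → ℝ, ((u ⬝ᵥ v : ℝ) : EReal) - f u

theorem EReal.coe_sub_le_comm (a : ℝ) (y z : EReal) :
    (a : EReal) - y ≤ z ↔ (a : EReal) - z ≤ y := by
  cases y with
  | bot => cases z <;> simp [sub_eq_add_neg, EReal.add_eq_bot_iff]
  | top => cases z <;> simp
  | coe y =>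
    cases z with
    | bot => simp [sub_eq_add_neg, EReal.add_eq_bot_iff]
    | top => simp
    | coe z => simp only [← EReal.coe_sub, EReal.coe_le_coe_iff, sub_le_comm]

theorem EReal.coe_add_le_iff (a : ℝ) (y z : EReal) :
    (a : EReal) + y ≤ z ↔ y ≤ z - a := by
  rw [EReal.le_sub_iff_add_le (.inl (EReal.coe_ne_bot a)) (.inl (EReal.coe_ne_top a)), add_comm]

theorem conj_le_iff {ι : Type*} [Fintype ι] (f : (ι → ℝ) → EReal) (v : ι → ℝ) (z : EReal) :
    conj f v ≤ z ↔ ∀ u : ι → ℝ, ((u ⬝ᵥ v : ℝ) : EReal) - z ≤ f u := by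
  simp only [conj, iSup_le_iff, EReal.coe_sub_le_comm _ (f _)]

theorem conj_iInf {ι κ : Type*} [Fintype ι] (f : κ → (ι → ℝ) → EReal) (v : ι → ℝ) :
    conj (fun u => ⨅ k, f k u) v = ⨆ k, conj (f k) v := by
  refine eq_of_forall_ge_iff fun z => ?_
  simp only [iSup_le_iff, conj_le_iff, le_iInf_iff]
  exact forall_comm

/-- The conjugate of the function `E α ↦ c α` for `α ∈ S`, `+∞` elsewhere. -/
theorem conj_iInf_mulVec_le_iff {ι κ : Type*} [Fintype ι] [Fintype κ] (E : Matrix ι κ ℝ)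
    (S : Set (κ → ℝ)) (c : (κ → ℝ) → ℝ) (v : ι → ℝ) (z : EReal) :
    conj (fun u => ⨅ α : κ → ℝ, ⨅ _ : α ∈ S ∧ u = E *ᵥ α, ((c α : ℝ) : EReal)) v ≤ z ↔
      ∀ α ∈ S, (((E *ᵥ α) ⬝ᵥ v - c α : ℝ) : EReal) ≤ z := by
  simp only [conj_le_iff, le_iInf_iff, EReal.coe_sub, EReal.coe_sub_le_comm _ (c _ : EReal)]
  exact ⟨fun h α hα => h _ α ⟨hα, rfl⟩, fun h u α ⟨hα, hu⟩ => hu ▸ h α hα⟩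

/-- The conjugate of a real function plus the indicator function of a set. -/
theorem conj_add_indicator_le_iff {ι : Type*} [Fintype ι] (f : (ι → ℝ) → ℝ)
    (C : Set (ι → ℝ)) (v : ι → ℝ) (z : EReal) :
    conj (fun r => ((f r : ℝ) : EReal) + ⨅ _ : r ∈ C, (0 : EReal)) v ≤ z ↔
      ∀ r ∈ C, ((r ⬝ᵥ v - f r : ℝ) : EReal) ≤ z := by
  simp only [conj, iSup_le_iff]
  refine forall_congr' fun r => ?_
  by_cases hr : r ∈ C <;> simp [hr]

section Barycentric

variable {n : ℕ} {p : Fin (n + 1) → Fin n → ℝ} {X : Matrix (Fin (n + 1)) (Fin (n + 1)) ℝ}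

theorem transpose_mulVec_castSucc
    (hX : ∀ j c, X j c = if h : (c : ℕ) < n then p j ⟨c, h⟩ else 1)
    (α : Fin (n + 1) → ℝ) (r : Fin n) : (Xᵀ *ᵥ α) r.castSucc = ∑ j, α j * p j r := by
  simp [mulVec, dotProduct, hX, mul_comm]

theorem transpose_mulVec_last
    (hX : ∀ j c, X j c = if h : (c : ℕ) < n then p j ⟨c, h⟩ else 1)
    (α : Fin (n + 1) → ℝ) : (Xᵀ *ᵥ α) (Fin.last n) = ∑ j, α j := by
  simp [mulVec, dotProduct, hX]

/-- The matrix of homogeneous coordinates of affinely independent points is invertible. -/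
theorem isUnit_det_transpose_of_affineIndependent (hp : AffineIndependent ℝ p)
    (hX : ∀ j c, X j c = if h : (c : ℕ) < n then p j ⟨c, h⟩ else 1) : IsUnit Xᵀ.det := by
  rw [isUnit_iff_ne_zero]
  intro hdet
  obtain ⟨α, hα, h⟩ := exists_mulVec_eq_zero_iff.mpr hdet
  refine hα (funext fun j => ?_)
  refine affineIndependent_iff.mp hp Finset.univ α ?_ ?_ j (Finset.mem_univ j)
  · rw [← transpose_mulVec_last hX, h, Pi.zero_apply]
  · ext r
    have hr := transpose_mulVec_castSucc hX α r
    rw [h] at hr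
    simpa using hr.symm

/-- A weight vector is recovered from the point it represents by an affine map. -/
theorem inv_transpose_barycentric (hp : AffineIndependent ℝ p)
    (hX : ∀ j c, X j c = if h : (c : ℕ) < n then p j ⟨c, h⟩ else 1)
    {A : Matrix (Fin (n + 1)) (Fin n) ℝ} (hA : ∀ j r, A j r = (Xᵀ)⁻¹ j r.castSucc)
    {b : Fin (n + 1) → ℝ} (hb : ∀ j, b j = (Xᵀ)⁻¹ j (Fin.last n))
    {T : Matrix (Fin n) (Fin (n + 1)) ℝ} (hT : ∀ r j, T r j = p j r)
    {α : Fin (n + 1) → ℝ} (hα : ∑ j, α j = 1) : A *ᵥ (T *ᵥ α) + b = α := by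
  have hinv : (Xᵀ)⁻¹ *ᵥ (Xᵀ *ᵥ α) = α := by
    rw [mulVec_mulVec, nonsing_inv_mul _ (isUnit_det_transpose_of_affineIndependent hp hX),
      one_mulVec]
  have hTα : ∀ r, (T *ᵥ α) r = (Xᵀ *ᵥ α) r.castSucc := fun r => by
    rw [transpose_mulVec_castSucc hX]
    simp [mulVec, dotProduct, hT, mul_comm]
  ext j
  conv_rhs => rw [← hinv]
  rw [Pi.add_apply, mulVec, mulVec, dotProduct, dotProduct, Fin.sum_univ_castSucc,
    transpose_mulVec_last hX, hα, mul_one, hb]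
  simp only [hA, hTα]

end Barycentric

/-- the biconjugate (convex envelope) of the lifted dataterm
`ρ̂(u) = min_i ρ̂_i(u)` (where `ρ̂_i(u) = ρ(T_i α)` if `u = E_i α` with `α` in the
unit simplex, `+∞` otherwise) is
`ρ̂**(u) = sup_v ⟨u, v⟩ − max_i [⟨E_i b_i, v⟩ + (ρ + δ_{Δ_i})*(A_iᵀ E_iᵀ v)]`,
where `M_i = (T_iᵀ, 𝟙)^{−ᵀ} = ((X_i)ᵀ)⁻¹` with `X_i = (T_iᵀ, 𝟙)`, `b_i` its last
column and `A_i` its first `n` columns.  The simplices `Δ_i = conv{t^{i_1}, …}`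
are non-degenerate with pairwise distinct vertex indices.  Here `ρ + δ_{Δ_i}`
is encoded as `r ↦ ρ(r) + (⨅ (_ : r ∈ Δ_i), 0)`, the infimum over the empty
index set being `+∞`. -/
theorem lifted_dataterm_biconjugate {n m L : ℕ}
    (t : Fin L → Fin n → ℝ)
    (idx : Fin m → Fin (n + 1) → Fin L)
    (hidx : ∀ i, Function.Injective (idx i))
    (hnd : ∀ i, AffineIndependent ℝ (fun j => t (idx i j)))
    (ρ : (Fin n → ℝ) → ℝ)
    (T : Fin m → Matrix (Fin n) (Fin (n + 1)) ℝ)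
    (hT : ∀ i r j, T i r j = t (idx i j) r)
    (E : Fin m → Matrix (Fin L) (Fin (n + 1)) ℝ)
    (hE : ∀ i k j, E i k j = if k = idx i j then 1 else 0)
    (X : Fin m → Matrix (Fin (n + 1)) (Fin (n + 1)) ℝ)
    (hX : ∀ i j c, X i j c = if h : (c : ℕ) < n then t (idx i j) ⟨c, h⟩ else 1)
    (M : Fin m → Matrix (Fin (n + 1)) (Fin (n + 1)) ℝ)
    (hM : ∀ i, M i = ((X i)ᵀ)⁻¹)
    (A : Fin m → Matrix (Fin (n + 1)) (Fin n) ℝ)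
    (hA : ∀ i j r, A i j r = M i j r.castSucc)
    (b : Fin m → Fin (n + 1) → ℝ)
    (hb : ∀ i j, b i j = M i j (Fin.last n))
    (ρhat : (Fin L → ℝ) → EReal)
    (hρhat : ∀ u, ρhat u = ⨅ i : Fin m, ⨅ α : Fin (n + 1) → ℝ,
      ⨅ _ : α ∈ stdSimplex ℝ (Fin (n + 1)) ∧ u = E i *ᵥ α, ((ρ (T i *ᵥ α) : ℝ) : EReal))
    (u : Fin L → ℝ) :
    conj (conj ρhat) u =
      ⨆ v : Fin L → ℝ, ((u ⬝ᵥ v : ℝ) : EReal) -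
        ⨆ i : Fin m,
          ((((E i *ᵥ b i) ⬝ᵥ v : ℝ) : EReal) +
            conj (fun r => ((ρ r : ℝ) : EReal) +
                ⨅ _ : r ∈ {r : Fin n → ℝ | ∃ α ∈ stdSimplex ℝ (Fin (n + 1)), r = T i *ᵥ α},
                  (0 : EReal))
              ((A i)ᵀ *ᵥ ((E i)ᵀ *ᵥ v))) := by
  have key : ∀ v : Fin L → ℝ, conj ρhat v = ⨆ i : Fin m,
      ((((E i *ᵥ b i) ⬝ᵥ v : ℝ) : EReal) +
        conj (fun r => ((ρ r : ℝ) : EReal) +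
            ⨅ _ : r ∈ {r : Fin n → ℝ | ∃ α ∈ stdSimplex ℝ (Fin (n + 1)), r = T i *ᵥ α},
              (0 : EReal))
          ((A i)ᵀ *ᵥ ((E i)ᵀ *ᵥ v))) := by
    intro v
    rw [funext hρhat, conj_iInf]
    refine iSup_congr fun i => eq_of_forall_ge_iff fun z => ?_
    rw [conj_iInf_mulVec_le_iff (E i) (stdSimplex ℝ (Fin (n + 1))) (fun α => ρ (T i *ᵥ α)),
      EReal.coe_add_le_iff, conj_add_indicator_le_iff]
    simp only [Set.mem_ofPred_eq, forall_exists_index, and_imp, forall_comm (α := Fin n → ℝ),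
      forall_eq, ← EReal.coe_add_le_iff, ← EReal.coe_add]
    refine forall₂_congr fun α hα => ?_
    have hbary : A i *ᵥ (T i *ᵥ α) + b i = α :=
      inv_transpose_barycentric (hnd i) (hX i) (fun j r => by rw [hA, hM])
        (fun j => by rw [hb, hM]) (hT i) hα.2
    have hlin : (E i *ᵥ α) ⬝ᵥ v = (E i *ᵥ b i) ⬝ᵥ v +
        (T i *ᵥ α) ⬝ᵥ ((A i)ᵀ *ᵥ ((E i)ᵀ *ᵥ v)) := by
      conv_lhs => rw [← hbary]
      rw [mulVec_add, add_dotProduct, add_comm, dotProduct_mulVec _ (A i)ᵀ, vecMul_transpose,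
        dotProduct_mulVec _ (E i)ᵀ, vecMul_transpose]
    rw [hlin, add_sub_assoc]
  rw [conj]
  exact iSup_congr fun v => by rw [key, dotProduct_comm]
end

section
/- Let t^1,…,t^{n+1} ∈ ℝⁿ be affinely independent, T := (t^1,…,t^{n+1}) ∈ ℝ^{n×(n+1)}, and let K ∈ ℝ^{(n+1)×(n+1)} be the matrix whose first n rows are T and whose last row is the all-ones row; K is invertible. Let M := K^{−ᵀ}, let A ∈ ℝ^{(n+1)×n} consist of the first n columns of M and b ∈ ℝ^{n+1} be its last column, and let Δ := conv{t^1,…,t^{n+1}}. Then for every function ρ : ℝⁿ → ℝ and every v ∈ ℝ^{n+1}: sup_{α ∈ Δ^U_{n+1}} (⟨α, v⟩ − ρ(Tα)) = ⟨b, v⟩ + sup_{r ∈ Δ} (⟨r, Aᵀ v⟩ − ρ(r)), i.e. the conjugate of α ↦ ρ(Tα) + δ_{Δ^U_{n+1}}(α) at v equals ⟨b, v⟩ + (ρ + δ_Δ)*(Aᵀ v). -/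
open Matrix

/-- The homogenization of an affinely independent family, written as a square matrix with the
points as columns above a row of ones, is invertible. -/
theorem isUnit_of_affineIndependent {n : ℕ}
    {t : Fin (n + 1) → Fin n → ℝ} (ht : AffineIndependent ℝ t)
    {K : Matrix (Fin (n + 1)) (Fin (n + 1)) ℝ}
    (hK : ∀ (r j : Fin (n + 1)), K r j = if h : (r : ℕ) < n then t j ⟨r, h⟩ else 1) :
    IsUnit K := by
  rw [← Matrix.mulVec_injective_iff_isUnit]
  refine (injective_iff_map_eq_zero K.mulVecLin).2 fun w hw => ?_
  rw [Matrix.mulVecLin_apply] at hw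
  have hsum : ∑ j, w j = 0 := by
    simpa [Matrix.mulVec, dotProduct, hK] using congrFun hw (Fin.last n)
  have hcomb : ∑ j, w j • t j = 0 := by
    ext r
    simpa [Matrix.mulVec, dotProduct, hK, mul_comm] using congrFun hw r.castSucc
  ext j
  exact affineIndependent_iff.1 ht Finset.univ w hsum hcomb j (Finset.mem_univ j)

/-- Barycentric coordinates are recovered from a point by applying the inverse homogenization. -/
theorem barycentric_eq_mulVec_add {n : ℕ}
    {T : Matrix (Fin n) (Fin (n + 1)) ℝ} {K M : Matrix (Fin (n + 1)) (Fin (n + 1)) ℝ}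
    (hKT : ∀ r j, K (Fin.castSucc r) j = T r j) (hK1 : ∀ j, K (Fin.last n) j = 1)
    (hMK : M * K = 1)
    {A : Matrix (Fin (n + 1)) (Fin n) ℝ} (hA : ∀ j r, A j r = M j r.castSucc)
    {b : Fin (n + 1) → ℝ} (hb : ∀ j, b j = M j (Fin.last n))
    {α : Fin (n + 1) → ℝ} (hα : ∑ j, α j = 1) :
    α = A *ᵥ (T *ᵥ α) + b := by
  have hlast : (K *ᵥ α) (Fin.last n) = 1 := by simp [Matrix.mulVec, dotProduct, hK1, hα]
  have hcast (r : Fin n) : (K *ᵥ α) r.castSucc = (T *ᵥ α) r := by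
    simp [Matrix.mulVec, dotProduct, hKT]
  calc α = M *ᵥ (K *ᵥ α) := by rw [Matrix.mulVec_mulVec, hMK, Matrix.one_mulVec]
    _ = A *ᵥ (T *ᵥ α) + b := by
      ext j
      change ∑ i, M j i * (K *ᵥ α) i = ∑ r, A j r * (T *ᵥ α) r + b j
      simp only [Fin.sum_univ_castSucc, hlast, hcast, hA, hb, mul_one]

/-- the conjugate of `α ↦ ρ(Tα) + δ_{Δ^U_{n+1}}(α)` at `v` equals
`⟨b, v⟩ + (ρ + δ_Δ)*(Aᵀ v)`, where `K` is the matrix whose first `n` rows are `T`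
and whose last row is all ones (invertible by affine independence), `M` is the
inverse-transpose of `(Tᵀ, 𝟙)`, i.e. `M = K⁻¹`, `A` consists of the first `n`
columns of `M` and `b` is its last column, and `Δ = conv{t^1, …, t^{n+1}}`. -/
theorem conj_dataterm_substitution {n : ℕ}
    (t : Fin (n + 1) → Fin n → ℝ) (ht : AffineIndependent ℝ t)
    (T : Matrix (Fin n) (Fin (n + 1)) ℝ) (hT : ∀ r j, T r j = t j r)
    (K : Matrix (Fin (n + 1)) (Fin (n + 1)) ℝ)
    (hK : ∀ (r j : Fin (n + 1)), K r j = if h : (r : ℕ) < n then t j ⟨r, h⟩ else 1)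
    (M : Matrix (Fin (n + 1)) (Fin (n + 1)) ℝ) (hM : M = K⁻¹)
    (A : Matrix (Fin (n + 1)) (Fin n) ℝ) (hA : ∀ j r, A j r = M j r.castSucc)
    (b : Fin (n + 1) → ℝ) (hb : ∀ j, b j = M j (Fin.last n))
    (ρ : (Fin n → ℝ) → ℝ) (v : Fin (n + 1) → ℝ) :
    (⨆ α ∈ stdSimplex ℝ (Fin (n + 1)), ((α ⬝ᵥ v - ρ (T *ᵥ α) : ℝ) : EReal)) =
      ((b ⬝ᵥ v : ℝ) : EReal) +
        ⨆ r ∈ {r : Fin n → ℝ | ∃ α ∈ stdSimplex ℝ (Fin (n + 1)), r = T *ᵥ α},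
          ((r ⬝ᵥ (Aᵀ *ᵥ v) - ρ r : ℝ) : EReal) := by
  have hMK : M * K = 1 := by
    rw [hM]
    exact Matrix.nonsing_inv_mul K
      ((Matrix.isUnit_iff_isUnit_det K).1 (isUnit_of_affineIndependent ht hK))
  have key (α : Fin (n + 1) → ℝ) (hα : α ∈ stdSimplex ℝ (Fin (n + 1))) :
      α ⬝ᵥ v - ρ (T *ᵥ α) =
        b ⬝ᵥ v + ((T *ᵥ α) ⬝ᵥ (Aᵀ *ᵥ v) - ρ (T *ᵥ α)) := by
    have hbary := barycentric_eq_mulVec_add (T := T) (K := K)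
      (fun r j => by simp [hK, hT]) (fun j => by simp [hK]) hMK hA hb hα.2
    have hdot : α ⬝ᵥ v = (T *ᵥ α) ⬝ᵥ (Aᵀ *ᵥ v) + b ⬝ᵥ v := by
      conv_lhs => rw [hbary]
      rw [add_dotProduct, Matrix.dotProduct_mulVec, Matrix.vecMul_transpose]
    rw [hdot]
    ring
  apply le_antisymm
  · refine iSup₂_le fun α hα => ?_
    rw [key α hα, EReal.coe_add]
    gcongr
    exact le_iSup₂_of_le (T *ᵥ α) ⟨α, hα, rfl⟩ le_rfl
  · rw [add_comm, ← EReal.le_sub_iff_add_le (.inl (EReal.coe_ne_bot _))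
      (.inl (EReal.coe_ne_top _))]
    refine iSup₂_le ?_
    rintro _ ⟨α, hα, rfl⟩
    rw [EReal.le_sub_iff_add_le (.inl (EReal.coe_ne_bot _)) (.inl (EReal.coe_ne_top _)),
      add_comm, ← EReal.coe_add, ← key α hα]
    exact le_iSup₂_of_le α hα le_rfl
end

section
/- Let t^1,…,t^{n+1} ∈ ℝⁿ be affinely independent, T := (t^1,…,t^{n+1}) ∈ ℝ^{n×(n+1)}, TD := (t^1 − t^{n+1},…,t^n − t^{n+1}) ∈ ℝ^{n×n} (invertible), and Δ := conv{t^1,…,t^{n+1}}. Let ρ : ℝⁿ → ℝ be any function. For ũ ∈ ℝⁿ set u := (ũ_1, …, ũ_n, 1 − Σ_{j=1}^n ũ_j) ∈ ℝ^{n+1}. Then sup_{v ∈ ℝ^{n+1}} [ ⟨u, v⟩ − sup_{α ∈ Δ^U_{n+1}} ( ⟨α, v⟩ − ρ(Tα) ) ] = (ρ + δ_Δ)**( t^{n+1} + TD ũ ). In words: for a triangulation consisting of a single simplex, the lifted biconjugate dataterm evaluated at the lifted representation of the point t^{n+1} + TD ũ equals the biconjugate of the dataterm restricted to Δ, i.e.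 the convexified unlifted dataterm. -/
open Matrix

/-- Affinely independent vertices admit an affine function with prescribed vertex values. -/
theorem AffineIndependent.exists_dotProduct_add_eq {n : ℕ} {t : Fin (n + 1) → Fin n → ℝ}
    (ht : AffineIndependent ℝ t) (v : Fin (n + 1) → ℝ) :
    ∃ (w : Fin n → ℝ) (c : ℝ), ∀ j, v j = t j ⬝ᵥ w + c := by
  let A : Matrix (Fin n) (Fin n) ℝ := fun j => t j.castSucc - t (Fin.last n)
  have hA : IsUnit A := by
    rw [← Matrix.linearIndependent_rows_iff_isUnit]
    have h := (affineIndependent_iff_linearIndependent_vsub ℝ t (Fin.last n)).1 ht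
    exact h.comp (fun j : Fin n => ⟨j.castSucc, (Fin.castSucc_lt_last j).ne⟩)
      fun a b hab => Fin.castSucc_injective n (congrArg Subtype.val hab)
  obtain ⟨w, hw⟩ := (Matrix.mulVec_surjective_iff_isUnit.2 hA)
    fun j => v j.castSucc - v (Fin.last n)
  refine ⟨w, v (Fin.last n) - t (Fin.last n) ⬝ᵥ w, fun j => ?_⟩
  induction j using Fin.lastCases with
  | last => ring
  | cast j =>
    have h : (t j.castSucc - t (Fin.last n)) ⬝ᵥ w = v j.castSucc - v (Fin.last n) :=
      congrFun hw j
    rw [sub_dotProduct] at h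
    linarith

/-- The conjugate of a real function restricted to the image of a set is a supremum over
that set. -/
theorem conj_add_indicator_image {ι κ : Type*} [Fintype ι] (S : Set κ) (g : κ → ι → ℝ)
    (ρ : (ι → ℝ) → ℝ) (w : ι → ℝ) :
    conj (fun r => ((ρ r : ℝ) : EReal) +
        ⨅ _ : r ∈ {r : ι → ℝ | ∃ α ∈ S, r = g α}, (0 : EReal)) w =
      ⨆ α ∈ S, ((g α ⬝ᵥ w - ρ (g α) : ℝ) : EReal) := by
  apply le_antisymm
  · refine iSup_le fun r => ?_
    by_cases hr : r ∈ {r : ι → ℝ | ∃ α ∈ S, r = g α}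
    · obtain ⟨α, hα, rfl⟩ := hr
      have h : (⨅ _ : g α ∈ {r : ι → ℝ | ∃ α ∈ S, r = g α}, (0 : EReal)) = 0 :=
        iInf_pos ⟨α, hα, rfl⟩
      beta_reduce
      rw [h, add_zero, ← EReal.coe_sub]
      exact le_iSup₂_of_le α hα le_rfl
    · beta_reduce
      rw [iInf_neg hr, EReal.coe_add_top, EReal.sub_top]
      exact bot_le
  · refine iSup₂_le fun α hα => le_iSup_of_le (g α) ?_
    have h : (⨅ _ : g α ∈ {r : ι → ℝ | ∃ α ∈ S, r = g α}, (0 : EReal)) = 0 :=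
      iInf_pos ⟨α, hα, rfl⟩
    beta_reduce
    rw [h, add_zero, ← EReal.coe_sub]

/-- for a triangulation consisting of a single non-degenerate simplex
`Δ = conv{t^1, …, t^{n+1}}` with vertex matrix `T` and difference matrix `TD`, and for
`u = (ũ_1, …, ũ_n, 1 − Σ_j ũ_j)`, the lifted biconjugate dataterm
`sup_v [⟨u, v⟩ − sup_{α ∈ Δ^U}(⟨α, v⟩ − ρ(Tα))]` equals the biconjugate
`(ρ + δ_Δ)**(t^{n+1} + TD ũ)` of the dataterm restricted to `Δ`.  Here `ρ + δ_Δ`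
is encoded as `r ↦ ρ(r) + (⨅ (_ : r ∈ Δ), 0)`, the infimum over the empty index
set being `+∞`. -/
theorem single_simplex_lifted_biconjugate {n : ℕ}
    (t : Fin (n + 1) → Fin n → ℝ) (ht : AffineIndependent ℝ t)
    (T : Matrix (Fin n) (Fin (n + 1)) ℝ) (hT : ∀ r j, T r j = t j r)
    (TD : Matrix (Fin n) (Fin n) ℝ)
    (hTD : ∀ s r, TD s r = t r.castSucc s - t (Fin.last n) s)
    (ρ : (Fin n → ℝ) → ℝ)
    (ut : Fin n → ℝ)
    (u : Fin (n + 1) → ℝ) (hu : u = Fin.snoc ut (1 - ∑ j, ut j)) :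
    (⨆ v : Fin (n + 1) → ℝ, ((u ⬝ᵥ v : ℝ) : EReal) -
        ⨆ α ∈ stdSimplex ℝ (Fin (n + 1)), ((α ⬝ᵥ v - ρ (T *ᵥ α) : ℝ) : EReal)) =
      conj (conj (fun r => ((ρ r : ℝ) : EReal) +
          ⨅ _ : r ∈ {r : Fin n → ℝ | ∃ α ∈ stdSimplex ℝ (Fin (n + 1)), r = T *ᵥ α},
            (0 : EReal)))
        (t (Fin.last n) + TD *ᵥ ut) := by
  have hx : t (Fin.last n) + TD *ᵥ ut = T *ᵥ u := by
    funext s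
    simp only [Pi.add_apply, mulVec, dotProduct, hTD, hT, hu, Fin.sum_univ_castSucc,
      Fin.snoc_castSucc, Fin.snoc_last, sub_mul, Finset.sum_sub_distrib, ← Finset.mul_sum]
    ring
  have hu_sum : ∑ j, u j = 1 := by
    simp [hu, Fin.sum_univ_castSucc]
  have hT_dot (α : Fin (n + 1) → ℝ) (w : Fin n → ℝ) :
      (T *ᵥ α) ⬝ᵥ w = α ⬝ᵥ (w ᵥ* T) := by
    rw [dotProduct_comm, dotProduct_mulVec, dotProduct_comm]
  rw [hx]
  apply le_antisymm
  · refine iSup_le fun v => ?_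
    obtain ⟨w, c, hv⟩ := ht.exists_dotProduct_add_eq v
    have hv_dot (α : Fin (n + 1) → ℝ) (hα : ∑ j, α j = 1) :
        α ⬝ᵥ v = (T *ᵥ α) ⬝ᵥ w + c := by
      have hv' : v = w ᵥ* T + fun _ => c := by
        funext j
        rw [hv j, dotProduct_comm]
        simp [vecMul, dotProduct, hT]
      rw [hT_dot, hv', dotProduct_add]
      simp [dotProduct, ← Finset.sum_mul, hα]
    refine le_iSup_of_le w ?_
    rw [conj_add_indicator_image, hv_dot u hu_sum, dotProduct_comm w]
    set K := ⨆ α ∈ stdSimplex ℝ (Fin (n + 1)), ((α ⬝ᵥ v - ρ (T *ᵥ α) : ℝ) : EReal)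
    have hle : (⨆ α ∈ stdSimplex ℝ (Fin (n + 1)),
        (((T *ᵥ α) ⬝ᵥ w - ρ (T *ᵥ α) : ℝ) : EReal)) ≤ K - (c : EReal) := by
      refine iSup₂_le fun α hα => ?_
      have h : ((α ⬝ᵥ v - ρ (T *ᵥ α) : ℝ) : EReal) ≤ K := le_iSup₂_of_le α hα le_rfl
      refine le_trans (le_of_eq ?_) (EReal.sub_le_sub h le_rfl)
      rw [← EReal.coe_sub, hv_dot α hα.2]
      congr 1
      ring
    refine le_trans (le_of_eq ?_) (EReal.sub_le_sub le_rfl hle)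
    induction K using EReal.rec with
    | bot => simp
    | top => simp
    | coe k =>
      norm_cast
      ring
  · refine iSup_le fun w => le_iSup_of_le (w ᵥ* T) ?_
    rw [conj_add_indicator_image, dotProduct_comm w]
    simp only [hT_dot]
    exact le_rfl
end

section
/- Let c ∈ ℝ^L and define f : ℝ^L → ℝ ∪ {+∞} by f(e^k) = c_k for k = 1,…,L (where e^k is the k-th standard basis vector) and f(u) = +∞ for all other u. Then the biconjugate of f is f**(u) = ⟨u, c⟩ for u in the unit simplex Δ^U_L and f**(u) = +∞ otherwise. (Thus prescribing the dataterm only at the labels yields a biconjugate that is linear on the feasible set, recovering the standard piecewise-linear relaxation.) -/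
open Matrix

/-- The conjugate of a function prescribed only at the standard basis vectors. -/
theorem conj_label_values {L : ℕ} (c : Fin L → ℝ) (f : (Fin L → ℝ) → EReal)
    (hf : ∀ u, f u = ⨅ k : Fin L, ⨅ _ : u = Pi.single k 1, ((c k : ℝ) : EReal))
    (v : Fin L → ℝ) : conj f v = ⨆ k : Fin L, ((v k - c k : ℝ) : EReal) := by
  apply le_antisymm
  · refine iSup_le fun u => ?_
    by_cases hu : ∃ k : Fin L, u = Pi.single k 1
    · obtain ⟨k, rfl⟩ := hu
      have hfk : f (Pi.single k 1) = ((c k : ℝ) : EReal) := by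
        rw [hf]
        refine le_antisymm (iInf_le_of_le k (iInf_le _ rfl)) (le_iInf₂ fun j hj => ?_)
        have hkj : k = j := by
          by_contra h
          have := congrFun hj k
          simp [h] at this
        rw [hkj]
      rw [hfk, single_one_dotProduct, ← EReal.coe_sub]
      exact le_iSup (fun k : Fin L => ((v k - c k : ℝ) : EReal)) k
    · have hfu : f u = ⊤ := by
        rw [hf]
        simp only [iInf_eq_top]
        exact fun k hk => absurd ⟨k, hk⟩ hu
      rw [hfu, EReal.sub_top]
      exact bot_le
  · refine iSup_le fun k => ?_
    refine le_trans ?_ (le_iSup (fun u => ((u ⬝ᵥ v : ℝ) : EReal) - f u) (Pi.single k 1))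
    rw [single_one_dotProduct, EReal.coe_sub]
    refine EReal.sub_le_sub le_rfl ?_
    rw [hf]
    exact iInf_le_of_le k (iInf_le _ rfl)

/-- An upper bound on a conjugate gives a lower bound on the next conjugate. -/
theorem le_conj_of_le {ι : Type*} [Fintype ι] {g : (ι → ℝ) → EReal} {v : ι → ℝ} {M : ℝ}
    (h : g v ≤ M) (u : ι → ℝ) : ((u ⬝ᵥ v - M : ℝ) : EReal) ≤ conj g u := by
  refine le_trans ?_ (le_iSup (fun w => ((w ⬝ᵥ u : ℝ) : EReal) - g w) v)
  rw [EReal.coe_sub, dotProduct_comm]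
  exact EReal.sub_le_sub le_rfl h

/-- if `f : ℝ^L → ℝ ∪ {+∞}` takes the value `c_k` at the `k`-th
standard basis vector `e^k` and `+∞` everywhere else, then its biconjugate is
`f**(u) = ⟨u, c⟩` for `u` in the unit simplex and `f**(u) = +∞` otherwise. -/
theorem biconj_of_label_values {L : ℕ} (c : Fin L → ℝ)
    (f : (Fin L → ℝ) → EReal)
    (hf : ∀ u, f u = ⨅ k : Fin L, ⨅ _ : u = Pi.single k 1, ((c k : ℝ) : EReal)) :
    (∀ u ∈ stdSimplex ℝ (Fin L), conj (conj f) u = ((u ⬝ᵥ c : ℝ) : EReal)) ∧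
      (∀ u ∉ stdSimplex ℝ (Fin L), conj (conj f) u = ⊤) := by
  have hle : ∀ (v : Fin L → ℝ) (M : ℝ), (∀ k, v k - c k ≤ M) → conj f v ≤ M := by
    intro v M h
    rw [conj_label_values c f hf]
    exact iSup_le fun k => EReal.coe_le_coe_iff.2 (h k)
  refine ⟨fun u hu => le_antisymm (iSup_le fun v => ?_) ?_, fun u hu => ?_⟩
  · have : Nonempty (Fin L) := by
      by_contra h
      rw [not_nonempty_iff] at h
      have := hu.2
      simp at this
    obtain ⟨k, hk⟩ := Finite.exists_max fun k => v k - c k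
    have hM : ((v k - c k : ℝ) : EReal) ≤ conj f v := by
      rw [conj_label_values c f hf]
      exact le_iSup (fun k : Fin L => ((v k - c k : ℝ) : EReal)) k
    refine (EReal.sub_le_sub le_rfl hM).trans ?_
    rw [← EReal.coe_sub, EReal.coe_le_coe_iff, dotProduct_comm, sub_le_iff_le_add']
    calc u ⬝ᵥ v = ∑ j, u j * v j := rfl
      _ ≤ ∑ j, (u j * (v k - c k) + u j * c j) :=
        Finset.sum_le_sum fun j _ => by
          have := mul_le_mul_of_nonneg_left (hk j) (hu.1 j)
          linarith
      _ = v k - c k + u ⬝ᵥ c := by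
        rw [Finset.sum_add_distrib, ← Finset.sum_mul, hu.2, one_mul]
        rfl
  · simpa using le_conj_of_le (hle c 0 (by simp)) u
  · rw [EReal.eq_top_iff_forall_lt]
    intro R
    suffices ∃ (v : Fin L → ℝ) (M : ℝ), (∀ k, v k - c k ≤ M) ∧ R < u ⬝ᵥ v - M by
      obtain ⟨v, M, hv, hR⟩ := this
      exact (EReal.coe_lt_coe_iff.2 hR).trans_le (le_conj_of_le (hle v M hv) u)
    by_cases hpos : ∀ i, 0 ≤ u i
    · have hsum : ∑ i, u i - 1 ≠ 0 := fun h => hu ⟨hpos, sub_eq_zero.1 h⟩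
      set t : ℝ := (R + 1 - u ⬝ᵥ c) / (∑ i, u i - 1)
      refine ⟨c + t • 1, t, by simp, ?_⟩
      have key : t * (∑ i, u i - 1) = R + 1 - u ⬝ᵥ c := div_mul_cancel₀ _ hsum
      rw [dotProduct_add, dotProduct_smul, dotProduct_one, smul_eq_mul]
      linarith
    · push Not at hpos
      obtain ⟨i, hi⟩ := hpos
      set t : ℝ := (|R - u ⬝ᵥ c| + 1) / (-u i)
      have ht0 : 0 ≤ t := div_nonneg (by positivity) (by linarith)
      have key : t * (-u i) = |R - u ⬝ᵥ c| + 1 := div_mul_cancel₀ _ (by linarith)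
      refine ⟨c - Pi.single i t, 0, fun k => ?_, ?_⟩
      · have : 0 ≤ (Pi.single i t : Fin L → ℝ) k := by
          have h : (0 : Fin L → ℝ) ≤ Pi.single i t := Pi.single_nonneg.2 ht0
          exact h k
        simpa using this
      · rw [dotProduct_sub, dotProduct_single]
        linarith [le_abs_self (R - u ⬝ᵥ c)]
end
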